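/- arXiv:2003.07349 — 5 statements merged into one kernel-verified Lean document; each statement's English description precedes it below -/
import Mathlib

section
/- Let (E,r) be a ranked set (E finite, r : 2^E → ℤ) with two multiplicities m₁, m₂ : 2^E → K over a field K. Then for all a, b, c, d ∈ K with a, b, c, d all nonzero: T_{(E,r,m₁m₂)}(1−ab, 1−cd) = ∑_{A ⊆ E} a^{r(E)−r(A)} d^{|A|−r(A)} · T_{(E,r,m₁)|A}(1−a, 1−c) · T_{(E,r,m₂)/A}(1−b, 1−d), where m₁m₂ is the pointwise product multiplicity and all exponents are integer (zpow) powers. -/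
open Finset

/-- The Tutte polynomial of the restriction `M|A` of the ranked set with multiplicity
`M = (E, r, m)` over a field `K`:
`T_{M|A}(x,y) = ∑_{B⊆A} m(B) (x−1)^{r(A)−r(B)} (y−1)^{|B|−r(B)}` (integer powers).
Taking `A = univ` gives the Tutte polynomial of `M` itself. -/
noncomputable def TutteRes {α K : Type*} [Field K]
    (r : Finset α → ℤ) (m : Finset α → K) (A : Finset α) (x y : K) : K :=
  ∑ B ∈ A.powerset, m B * (x - 1) ^ (r A - r B) * (y - 1) ^ ((B.card : ℤ) - r B)

/-- The Tutte polynomial of the contraction `M/A`: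
`T_{M/A}(x,y) = ∑_{B⊆E∖A} m(A∪B) (x−1)^{r(E)−r(A∪B)} (y−1)^{|B|−(r(A∪B)−r(A))}`. -/
noncomputable def TutteCon {α K : Type*} [Fintype α] [DecidableEq α] [Field K]
    (r : Finset α → ℤ) (m : Finset α → K) (A : Finset α) (x y : K) : K :=
  ∑ B ∈ Aᶜ.powerset, m (A ∪ B) * (x - 1) ^ (r Finset.univ - r (A ∪ B)) *
    (y - 1) ^ ((B.card : ℤ) - (r (A ∪ B) - r A))

/-- The alternating sum over an interval of finite sets vanishes unless its endpoints agree. -/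
theorem sum_Icc_neg_one_pow_card {α K : Type*} [DecidableEq α] [CommRing K] {B C : Finset α}
    (h : B ⊆ C) :
    ∑ A ∈ Icc B C, (-1 : K) ^ A.card = if B = C then (-1) ^ B.card else 0 := by
  have hinj : Set.InjOn (B ∪ ·) ((C \ B).powerset : Set (Finset α)) := by
    intro S hS T hT hST
    have hS' := disjoint_sdiff.mono_right (mem_powerset.1 hS)
    have hT' := disjoint_sdiff.mono_right (mem_powerset.1 hT)
    rw [← union_sdiff_cancel_left hS', ← union_sdiff_cancel_left hT']
    exact congrArg (· \ B) hST
  have hcard : ∀ S ∈ (C \ B).powerset,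
      (-1 : K) ^ (B ∪ S).card = (-1) ^ B.card * (-1) ^ S.card := by
    intro S hS
    rw [card_union_of_disjoint (disjoint_sdiff.mono_right (mem_powerset.1 hS)), pow_add]
  have halt := congrArg (Int.cast : ℤ → K) (sum_powerset_neg_one_pow_card (x := C \ B))
  push_cast at halt
  have hiff : C \ B = ∅ ↔ B = C := by
    rw [sdiff_eq_empty_iff_subset]
    exact ⟨fun h' => h.antisymm h', fun h' => h'.ge⟩
  rw [Icc_eq_image_powerset h, sum_image hinj, sum_congr rfl hcard, ← mul_sum, halt]
  simp [hiff]

/-- The Tutte polynomial of a contraction as a sum over the supersets of the contracted set. -/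
theorem TutteCon_eq_sum_Icc {α K : Type*} [Fintype α] [DecidableEq α] [Field K]
    (r : Finset α → ℤ) (m : Finset α → K) (A : Finset α) (x y : K) :
    TutteCon r m A x y = ∑ C ∈ Icc A univ, m C * (x - 1) ^ (r univ - r C) *
      (y - 1) ^ ((C.card : ℤ) - A.card - (r C - r A)) := by
  unfold TutteCon
  refine sum_bij' (fun B _ => A ∪ B) (fun C _ => C \ A) ?_ ?_ ?_ ?_ ?_
  · simp
  · intro C _
    simp [subset_compl_iff_disjoint_right, sdiff_disjoint]
  · intro B hB
    rw [mem_powerset, subset_compl_iff_disjoint_right] at hB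
    exact union_sdiff_cancel_left hB.symm
  · intro C hC
    exact union_sdiff_of_subset (mem_Icc.1 hC).1
  · intro B hB
    rw [mem_powerset, subset_compl_iff_disjoint_right] at hB
    rw [card_union_of_disjoint hB.symm]
    push_cast
    rw [add_sub_cancel_left]

/-- **Theorem 3.7** (convolution formula for Tutte polynomials): for a ranked set `(E,r)`
with two multiplicities `m₁, m₂` over a field `K` and nonzero `a, b, c, d ∈ K`,
`T_{(E,r,m₁m₂)}(1−ab, 1−cd)
  = ∑_{A⊆E} a^{r(E)−r(A)} d^{|A|−r(A)} T_{(E,r,m₁)|A}(1−a,1−c) T_{(E,r,m₂)/A}(1−b,1−d)`. -/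
theorem convolution_Tutte {α K : Type*} [Fintype α] [DecidableEq α] [Field K]
    (r : Finset α → ℤ) (m₁ m₂ : Finset α → K) (a b c d : K)
    (ha : a ≠ 0) (hb : b ≠ 0) (hc : c ≠ 0) (hd : d ≠ 0) :
    TutteRes r (fun A => m₁ A * m₂ A) Finset.univ (1 - a * b) (1 - c * d) =
      ∑ A : Finset α, a ^ (r Finset.univ - r A) * d ^ ((A.card : ℤ) - r A) *
        TutteRes r m₁ A (1 - a) (1 - c) * TutteCon r m₂ A (1 - b) (1 - d) := by
  set F : Finset α → Finset α → K := fun B C =>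
    m₁ B * m₂ C * a ^ (r univ - r B) * (-c) ^ ((B.card : ℤ) - r B) *
      (-b) ^ (r univ - r C) * d ^ ((C.card : ℤ) - r C) *
      (-1) ^ ((C.card : ℤ) - r C - r B) with hF
  have hterm : ∀ A : Finset α, a ^ (r univ - r A) * d ^ ((A.card : ℤ) - r A) *
      TutteRes r m₁ A (1 - a) (1 - c) * TutteCon r m₂ A (1 - b) (1 - d) =
      ∑ B ∈ A.powerset, ∑ C ∈ Icc A univ, F B C * (-1) ^ A.card := by
    intro A
    rw [TutteCon_eq_sum_Icc, TutteRes, mul_assoc, sum_mul_sum, mul_sum]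
    refine sum_congr rfl fun B _ => ?_
    rw [mul_sum]
    refine sum_congr rfl fun C _ => ?_
    have hneg : (-1 : K) ≠ 0 := neg_ne_zero.2 one_ne_zero
    have hsign : (-1 : K) ^ (r A - r B) * (-1) ^ ((C.card : ℤ) - A.card - (r C - r A)) =
        (-1) ^ ((C.card : ℤ) - r C - r B) * (-1) ^ A.card := by
      rw [← zpow_natCast, ← zpow_add₀ hneg, ← zpow_add₀ hneg,
        show r A - r B + ((C.card : ℤ) - A.card - (r C - r A)) =
          (C.card - r C - r B + A.card) + 2 * (r A - A.card) by ring,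
        zpow_add₀ hneg _ (2 * _), zpow_mul]
      simp
    have hapow : a ^ (r univ - r A) * a ^ (r A - r B) = a ^ (r univ - r B) := by
      rw [← zpow_add₀ ha, sub_add_sub_cancel]
    have hdpow : d ^ ((A.card : ℤ) - r A) * d ^ ((C.card : ℤ) - A.card - (r C - r A)) =
        d ^ ((C.card : ℤ) - r C) := by
      rw [← zpow_add₀ hd]
      congr 1
      ring
    simp only [sub_sub_cancel_left, hF]
    rw [← neg_one_mul a, ← neg_one_mul d, mul_zpow, mul_zpow, ← hapow, ← hdpow]
    linear_combination m₁ B * m₂ C * a ^ (r univ - r A) * a ^ (r A - r B) *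
      (-c) ^ ((B.card : ℤ) - r B) * (-b) ^ (r univ - r C) * d ^ ((A.card : ℤ) - r A) *
      d ^ ((C.card : ℤ) - A.card - (r C - r A)) * hsign
  have hdiag : ∀ B, F B B * (-1) ^ B.card =
      m₁ B * m₂ B * (-(a * b)) ^ (r univ - r B) * (-(c * d)) ^ ((B.card : ℤ) - r B) := by
    intro B
    have hneg : (-1 : K) ≠ 0 := neg_ne_zero.2 one_ne_zero
    have hsign : (-1 : K) ^ ((B.card : ℤ) - r B - r B) * (-1) ^ B.card = 1 := by
      rw [← zpow_natCast, ← zpow_add₀ hneg,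
        show (B.card : ℤ) - r B - r B + B.card = 2 * (B.card - r B) by ring, zpow_mul]
      simp
    simp only [hF]
    rw [← mul_neg, ← neg_mul, mul_zpow, mul_zpow]
    linear_combination m₁ B * m₂ B * a ^ (r univ - r B) * (-c) ^ ((B.card : ℤ) - r B) *
      (-b) ^ (r univ - r B) * d ^ ((B.card : ℤ) - r B) * hsign
  have hswap : ∑ A : Finset α, ∑ B ∈ A.powerset, ∑ C ∈ Icc A univ, F B C * (-1) ^ A.card =
      ∑ B : Finset α, ∑ C ∈ Icc B univ, ∑ A ∈ Icc B C, F B C * (-1) ^ A.card := by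
    rw [sum_comm' (t' := univ) (s' := fun B => Icc B univ) (by simp)]
    refine sum_congr rfl fun B _ => sum_comm' fun A C => ?_
    simp only [mem_Icc, subset_univ, and_true]
    exact ⟨fun h => ⟨h, h.1.trans h.2⟩, fun h => h.1⟩
  rw [sum_congr rfl fun A _ => hterm A, hswap, TutteRes, powerset_univ]
  refine sum_congr rfl fun B _ => ?_
  rw [sum_congr rfl fun C hC => by
    rw [← mul_sum, sum_Icc_neg_one_pow_card (mem_Icc.1 hC).1]]
  simp [hdiag]
end

section
/- Let M=(E,r,m) be an rsm over a field K and x, y ∈ K with x ≠ 1 and y ≠ 1. Then for every family p=(p_e)_{e∈E} in K, the expectation of the modified Tutte polynomial of the random restriction satisfies: E[(x−1)^{−r(E_p)} T_{M|E_p}(x,y)] = ∑_{A⊆E} (x−1)^{−r(A)} T_{M|A}(x,y) · p^A (1−p)^{E∖A} = Z_M((x−1)(y−1), (p_e(y−1))_{e∈E}). -/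
open Finset

/-- The multivariate Tutte polynomial `Z_M(q,v) = ∑_{A⊆E} m(A) q^{−r(A)} v^A`. -/
noncomputable def Zmulti {α K : Type*} [Fintype α] [Field K]
    (r : Finset α → ℤ) (m : Finset α → K) (q : K) (v : α → K) : K :=
  ∑ A : Finset α, m A * q ^ (-(r A)) * ∏ e ∈ A, v e

/-- A random subset contains `B` with probability `∏ e ∈ B, p e`. -/
theorem sum_superset_prod_mul_prod_compl_one_sub {α R : Type*} [Fintype α] [DecidableEq α]
    [CommRing R] (p : α → R) (B : Finset α) :
    (∑ A : Finset α, if B ⊆ A then (∏ e ∈ A, p e) * ∏ e ∈ Aᶜ, (1 - p e) else 0) =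
      ∏ e ∈ B, p e := by
  have h := Fintype.prod_add p (fun e => if e ∉ B then 1 - p e else 0)
  have hprod : ∏ e, (p e + if e ∉ B then 1 - p e else 0) = ∏ e ∈ B, p e := by
    rw [← Fintype.prod_ite_mem B]
    refine Finset.prod_congr rfl fun e _ => ?_
    by_cases he : e ∈ B <;> simp [he]
  rw [← hprod, h]
  refine Finset.sum_congr rfl fun A _ => ?_
  have hA : (∀ e ∈ Aᶜ, e ∉ B) ↔ B ⊆ A := by
    simp only [Finset.mem_compl, Finset.subset_iff]
    exact forall_congr' fun e => not_imp_not
  rw [Finset.prod_ite_zero]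
  simp only [hA, mul_ite, mul_zero]

/-- **Proposition 4.1** (expected modified Tutte polynomial of a random restriction): for
an rsm `M = (E,r,m)` over a field `K`, `x ≠ 1`, `y ≠ 1`, and every family `p`,
`E[(x−1)^{−r(E_p)} T_{M|E_p}(x,y)]
  = ∑_{A⊆E} (x−1)^{−r(A)} T_{M|A}(x,y) p^A (1−p)^{E∖A}
  = Z_M((x−1)(y−1), (p_e(y−1)))`. -/
theorem expectation_modified_Tutte_restriction {α K : Type*} [Fintype α] [DecidableEq α]
    [Field K] (r : Finset α → ℤ) (m : Finset α → K) (x y : K)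
    (hx : x ≠ 1) (hy : y ≠ 1) (p : α → K) :
    (∑ A : Finset α,
        (x - 1) ^ (-(r A)) * TutteRes r m A x y * (∏ e ∈ A, p e) * ∏ e ∈ Aᶜ, (1 - p e)) =
      Zmulti r m ((x - 1) * (y - 1)) (fun e => p e * (y - 1)) := by
  have hx' : x - 1 ≠ 0 := sub_ne_zero.mpr hx
  have hy' : y - 1 ≠ 0 := sub_ne_zero.mpr hy
  have hT (A : Finset α) : (x - 1) ^ (-(r A)) * TutteRes r m A x y =
      ∑ B : Finset α, if B ⊆ A then
        m B * ((x - 1) * (y - 1)) ^ (-(r B)) * (y - 1) ^ B.card else 0 := by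
    rw [← Finset.sum_filter, TutteRes, Finset.mul_sum]
    refine Finset.sum_congr (by ext B; simp) fun B _ => ?_
    rw [mul_zpow, sub_eq_add_neg (r A), sub_eq_add_neg (B.card : ℤ), zpow_add₀ hx',
      zpow_add₀ hy', zpow_natCast, zpow_neg (x - 1) (r A)]
    have hA : (x - 1) ^ r A ≠ 0 := zpow_ne_zero _ hx'
    linear_combination (m B * (x - 1) ^ (-(r B)) * (y - 1) ^ B.card * (y - 1) ^ (-(r B))) *
      inv_mul_cancel₀ hA
  simp_rw [hT, mul_assoc _ (∏ e ∈ _, p e), Finset.sum_mul]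
  rw [Finset.sum_comm, Zmulti]
  refine Finset.sum_congr rfl fun B _ => ?_
  rw [Finset.prod_mul_distrib, Finset.prod_const,
    ← sum_superset_prod_mul_prod_compl_one_sub p B, Finset.sum_mul, Finset.mul_sum]
  refine Finset.sum_congr rfl fun A _ => ?_
  split_ifs <;> ring
end

section
/- Let M=(E,r,m) be an rsm over a field K and x ∈ K with x ≠ 1, and define T_{M/A}(x,2) := ∑_{B⊆E∖A} m(A∪B) (x−1)^{r(E)−r(A∪B)} (integer zpow powers; this is the Tutte polynomial of the contraction M/A evaluated at y = 2). Then for every family p=(p_e)_{e∈E} in K: E[T_{M/E_p}(x,2)] = ∑_{A⊆E} T_{M/A}(x,2) p^A (1−p)^{E∖A} = ∑_{B⊆E} m(B) (x−1)^{r(E)−r(B)} (1−p)^{E∖B}; in particular, if p_e ≠ 1 for all e, this equals (x−1)^{r(E)} (1−p)^E · Z_M(x−1, (1/(1−p_e))_{e∈E}). -/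
open Finset

/-- The Tutte polynomial of the contraction `M/A` evaluated at `y = 2`:
`T_{M/A}(x,2) = ∑_{B⊆E∖A} m(A∪B)(x−1)^{r(E)−r(A∪B)}` (integer powers). -/
noncomputable def TutteConAtTwo {α K : Type*} [Fintype α] [DecidableEq α] [Field K]
    (r : Finset α → ℤ) (m : Finset α → K) (A : Finset α) (x : K) : K :=
  ∑ B ∈ Aᶜ.powerset, m (A ∪ B) * (x - 1) ^ (r Finset.univ - r (A ∪ B))

/-- Summing `p^A (1 - p)^{E \ A}` over the subsets `A` of `C` leaves `(1 - p)^{E \ C}`. -/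
theorem sum_powerset_prod_mul_prod_compl_one_sub {α R : Type*} [Fintype α] [DecidableEq α]
    [CommRing R] (p : α → R) (C : Finset α) :
    ∑ A ∈ C.powerset, (∏ e ∈ A, p e) * ∏ e ∈ Aᶜ, (1 - p e) = ∏ e ∈ Cᶜ, (1 - p e) := by
  have hsplit : ∀ A ∈ C.powerset, (∏ e ∈ A, p e) * ∏ e ∈ Aᶜ, (1 - p e) =
      ((∏ e ∈ A, p e) * ∏ e ∈ C \ A, (1 - p e)) * ∏ e ∈ Cᶜ, (1 - p e) := by
    intro A hA
    have hAC := mem_powerset.1 hA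
    have hdisj : Disjoint (C \ A) Cᶜ := disjoint_compl_right.mono_left sdiff_subset
    have hunion : Aᶜ = (C \ A) ∪ Cᶜ := by
      ext e
      have := @hAC e
      simp only [mem_compl, mem_union, mem_sdiff]
      tauto
    rw [hunion, prod_union hdisj, mul_assoc]
  rw [sum_congr rfl hsplit, ← sum_mul, ← prod_add]
  simp

/-- Subsets of `Aᶜ` correspond to supersets of `A` through union with `A`. -/
theorem sum_powerset_compl_union {α R : Type*} [Fintype α] [DecidableEq α] [AddCommMonoid R]
    (g : Finset α → R) (A : Finset α) :
    ∑ B ∈ Aᶜ.powerset, g (A ∪ B) = ∑ C : Finset α with A ⊆ C, g C := by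
  refine sum_bij' (fun B _ => A ∪ B) (fun C _ => C \ A) ?_ ?_ ?_ ?_ ?_
  · simp
  · intro C _
    simp [sdiff_eq_inter_compl, inter_subset_right]
  · intro B hB
    exact union_sdiff_cancel_left
      (disjoint_compl_right.mono_right (mem_powerset.1 hB))
  · intro C hC
    exact union_sdiff_of_subset (mem_filter.1 hC).2
  · simp

theorem sum_TutteConAtTwo_mul_prod {α K : Type*} [Fintype α] [DecidableEq α] [Field K]
    (r : Finset α → ℤ) (m : Finset α → K) (x : K) (p : α → K) :
    (∑ A : Finset α, TutteConAtTwo r m A x * (∏ e ∈ A, p e) * ∏ e ∈ Aᶜ, (1 - p e)) =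
      ∑ B : Finset α, m B * (x - 1) ^ (r Finset.univ - r B) * ∏ e ∈ Bᶜ, (1 - p e) := by
  simp_rw [TutteConAtTwo,
    sum_powerset_compl_union (fun C => m C * (x - 1) ^ (r Finset.univ - r C)), mul_assoc, sum_mul]
  rw [sum_comm' (t' := univ) (s' := fun C => C.powerset) (by simp)]
  refine sum_congr rfl fun C _ => ?_
  rw [← mul_sum, sum_powerset_prod_mul_prod_compl_one_sub, mul_assoc]

/-- **Corollary 4.3** (expected Tutte polynomial at `(x,2)` of a random contraction): for
an rsm `M = (E,r,m)` over a field `K`, `x ≠ 1`, and every family `p`,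
`E[T_{M/E_p}(x,2)] = ∑_{A⊆E} T_{M/A}(x,2) p^A (1−p)^{E∖A}
  = ∑_{B⊆E} m(B)(x−1)^{r(E)−r(B)} (1−p)^{E∖B}`;
in particular if `p_e ≠ 1` for all `e` this equals
`(x−1)^{r(E)} (1−p)^E Z_M(x−1, (1/(1−p_e)))`. -/
theorem expectation_Tutte_x2_contraction {α K : Type*} [Fintype α] [DecidableEq α] [Field K]
    (r : Finset α → ℤ) (m : Finset α → K) (x : K) (hx : x ≠ 1) (p : α → K) :
    ((∑ A : Finset α, TutteConAtTwo r m A x * (∏ e ∈ A, p e) * ∏ e ∈ Aᶜ, (1 - p e)) =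
        ∑ B : Finset α, m B * (x - 1) ^ (r Finset.univ - r B) * ∏ e ∈ Bᶜ, (1 - p e)) ∧
    ((∀ e, p e ≠ 1) →
      (∑ A : Finset α, TutteConAtTwo r m A x * (∏ e ∈ A, p e) * ∏ e ∈ Aᶜ, (1 - p e)) =
        (x - 1) ^ (r Finset.univ) * (∏ e : α, (1 - p e)) *
          ∑ A : Finset α, m A * (x - 1) ^ (-(r A)) * ∏ e ∈ A, (1 / (1 - p e))) := by
  refine ⟨sum_TutteConAtTwo_mul_prod r m x p, fun hp => ?_⟩
  rw [sum_TutteConAtTwo_mul_prod, mul_sum]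
  refine sum_congr rfl fun B _ => ?_
  have hB : ∏ e ∈ B, (1 - p e) ≠ 0 := prod_ne_zero_iff.2 fun e _ => sub_ne_zero.2 (hp e).symm
  rw [sub_eq_add_neg (r univ), zpow_add₀ (sub_ne_zero.2 hx), ← prod_mul_prod_compl B fun e => 1 - p e,
    prod_div_distrib, prod_const_one]
  field_simp
end

section
/- Let M=(E,r,m) be an rsm over a field K and t ∈ K with t ≠ 0. Then for all families u=(u_e)_{e∈E} and v=(v_e)_{e∈E} in K: ∑_{A⊆E} (−1)^{|A|} Z_{M|A}(t, u) · v^A (1−v)^{E∖A} = ∑_{B⊆E} m(B) t^{−r(B)} (∏_{e∈B}(−u_e v_e)) (∏_{e∈E∖B}(1−2v_e)). In particular, if 2v_e ≠ 1 for all e, the right-hand side equals (1−2v)^E · Z_M(t, (u_e v_e/(2v_e−1))_{e∈E}), so E[(−1)^{|E_p|} Z_{M|E_p}(t,u)] = (1−2p)^E Z_M(t, (u_e p_e/(2p_e−1))_{e∈E}) whenever 2p_e ≠ 1 for all e. -/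
open Finset

/-- `Z_{M|A}(q,u) = ∑_{B⊆A} m(B) q^{−r(B)} u^B`, the multivariate Tutte polynomial of the
restriction `M|A`. -/
noncomputable def ZmultiRes {α K : Type*} [Field K]
    (r : Finset α → ℤ) (m : Finset α → K) (A : Finset α) (q : K) (u : α → K) : K :=
  ∑ B ∈ A.powerset, m B * q ^ (-(r B)) * ∏ e ∈ B, u e

/-- Expansion of a product of sums, restricted to the terms indexed by supersets of `B`. -/
theorem sum_superset_prod_mul_prod_compl {α R : Type*} [Fintype α] [DecidableEq α]
    [CommSemiring R] (f g : α → R) (B : Finset α) :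
    (∑ A : Finset α, if B ⊆ A then (∏ e ∈ A, f e) * ∏ e ∈ Aᶜ, g e else 0) =
      (∏ e ∈ B, f e) * ∏ e ∈ Bᶜ, (f e + g e) := by
  have h := Fintype.prod_add f (fun e => if e ∈ B then 0 else g e)
  rw [← prod_mul_prod_compl B] at h
  have hB : ∏ e ∈ B, (f e + if e ∈ B then 0 else g e) = ∏ e ∈ B, f e :=
    prod_congr rfl fun e he => by simp [he]
  have hBc : ∏ e ∈ Bᶜ, (f e + if e ∈ B then 0 else g e) = ∏ e ∈ Bᶜ, (f e + g e) :=
    prod_congr rfl fun e he => by simp [mem_compl.mp he]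
  rw [hB, hBc] at h
  rw [h]
  refine sum_congr rfl fun A _ => ?_
  split_ifs with hBA
  · congr 1
    refine prod_congr rfl fun e he => ?_
    rw [if_neg fun heB => mem_compl.mp he (hBA heB)]
  · obtain ⟨e, heB, heA⟩ := not_subset.mp hBA
    have hzero : ∏ e ∈ Aᶜ, (if e ∈ B then 0 else g e) = 0 :=
      prod_eq_zero (mem_compl.mpr heA) (if_pos heB)
    rw [hzero, mul_zero]

/-- **Theorem 4.7** (signed multivariate Tutte polynomial of a random restriction): for an
rsm `M = (E,r,m)` over a field `K`, `t ≠ 0`, and all families `u, v`,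
`∑_{A⊆E} (−1)^{|A|} Z_{M|A}(t,u) v^A (1−v)^{E∖A}
  = ∑_{B⊆E} m(B) t^{−r(B)} (∏_{e∈B}(−u_e v_e))(∏_{e∈E∖B}(1−2v_e))`;
in particular, if `2v_e ≠ 1` for all `e`, then
`E[(−1)^{|E_v|} Z_{M|E_v}(t,u)] = (1−2v)^E Z_M(t, (u_e v_e/(2v_e−1)))`. -/
theorem expectation_signed_Zmulti_restriction {α K : Type*} [Fintype α] [DecidableEq α]
    [Field K] (r : Finset α → ℤ) (m : Finset α → K) (t : K) (ht : t ≠ 0) (u v : α → K) :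
    ((∑ A : Finset α,
        (-1 : K) ^ A.card * ZmultiRes r m A t u * (∏ e ∈ A, v e) * ∏ e ∈ Aᶜ, (1 - v e)) =
      ∑ B : Finset α, m B * t ^ (-(r B)) *
        (∏ e ∈ B, (-(u e * v e))) * ∏ e ∈ Bᶜ, (1 - 2 * v e)) ∧
    ((∀ e, 2 * v e ≠ 1) →
      (∑ A : Finset α,
          (-1 : K) ^ A.card * ZmultiRes r m A t u * (∏ e ∈ A, v e) * ∏ e ∈ Aᶜ, (1 - v e)) =
        (∏ e : α, (1 - 2 * v e)) *
          ∑ B : Finset α, m B * t ^ (-(r B)) *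
            ∏ e ∈ B, (u e * v e / (2 * v e - 1))) := by
  have main : (∑ A : Finset α,
        (-1 : K) ^ A.card * ZmultiRes r m A t u * (∏ e ∈ A, v e) * ∏ e ∈ Aᶜ, (1 - v e)) =
      ∑ B : Finset α, m B * t ^ (-(r B)) *
        (∏ e ∈ B, (-(u e * v e))) * ∏ e ∈ Bᶜ, (1 - 2 * v e) := by
    have expand (A : Finset α) :
        (-1 : K) ^ A.card * ZmultiRes r m A t u * (∏ e ∈ A, v e) * ∏ e ∈ Aᶜ, (1 - v e) =
          ∑ B : Finset α, m B * t ^ (-(r B)) * (∏ e ∈ B, u e) *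
            if B ⊆ A then (∏ e ∈ A, -v e) * ∏ e ∈ Aᶜ, (1 - v e) else 0 := by
      have hZ : ZmultiRes r m A t u =
          ∑ B : Finset α, if B ⊆ A then m B * t ^ (-(r B)) * ∏ e ∈ B, u e else 0 := by
        rw [ZmultiRes, ← sum_filter]
        exact sum_congr (by ext; simp) fun _ _ => rfl
      rw [hZ, mul_sum, sum_mul, sum_mul, prod_neg]
      refine sum_congr rfl fun B _ => ?_
      split_ifs <;> ring
    simp_rw [expand]
    rw [sum_comm]
    refine sum_congr rfl fun B _ => ?_
    rw [← mul_sum, sum_superset_prod_mul_prod_compl]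
    have hneg : ∏ e ∈ B, (-(u e * v e)) = (∏ e ∈ B, u e) * ∏ e ∈ B, -v e := by
      simp_rw [← mul_neg, prod_mul_distrib]
    have hadd : ∏ e ∈ Bᶜ, (-v e + (1 - v e)) = ∏ e ∈ Bᶜ, (1 - 2 * v e) :=
      prod_congr rfl fun e _ => by ring
    rw [hneg, hadd]
    ring
  refine ⟨main, fun hv => ?_⟩
  rw [main, mul_sum]
  refine sum_congr rfl fun B _ => ?_
  have hB : ∏ e ∈ B, (-(u e * v e)) =
      (∏ e ∈ B, (1 - 2 * v e)) * ∏ e ∈ B, (u e * v e / (2 * v e - 1)) := by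
    rw [← prod_mul_distrib]
    refine prod_congr rfl fun e _ => ?_
    have he : 2 * v e - 1 ≠ 0 := sub_ne_zero.mpr (hv e)
    rw [← neg_sub (2 * v e) 1, neg_mul, mul_div_cancel₀ _ he]
  rw [hB, ← prod_mul_prod_compl B fun e => 1 - 2 * v e]
  ring
end

section
/- Let M=(E,r,m) be an rsm over a field K and s ∈ K with s ≠ 0. Then for all families u=(u_e)_{e∈E} and v=(v_e)_{e∈E} in K: ∑_{A⊆E} s^{−r(A)} (∏_{e∈A}(−v_e)) · Z_{M/A}(s, v) · u^A (1−u)^{E∖A} = ∑_{T⊆E} m(T) s^{−r(T)} v^T (∏_{e∈T}(1−2u_e)) (∏_{e∈E∖T}(1−u_e)). In particular, if u_e ≠ 1 for all e, the right-hand side equals (1−u)^E · Z_M(s, (v_e(1−2u_e)/(1−u_e))_{e∈E}), giving E[s^{−r(E_p)} (−v)^{E_p} Z_{M/E_p}(s,v)] = (1−p)^E Z_M(s, (v_e(1−2p_e)/(1−p_e))_{e∈E}) whenever p_e ≠ 1 for all e. -/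
open Finset

/-- `Z_{M/A}(q,v) = ∑_{B⊆E∖A} m(A∪B) q^{r(A)−r(A∪B)} v^B`, the multivariate Tutte
polynomial of the contraction `M/A`. -/
noncomputable def ZmultiCon {α K : Type*} [Fintype α] [DecidableEq α] [Field K]
    (r : Finset α → ℤ) (m : Finset α → K) (A : Finset α) (q : K) (v : α → K) : K :=
  ∑ B ∈ Aᶜ.powerset, m (A ∪ B) * q ^ (r A - r (A ∪ B)) * ∏ e ∈ B, v e

theorem sum_sum_powerset_compl {α R : Type*} [Fintype α] [DecidableEq α] [AddCommMonoid R]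
    (f : Finset α → Finset α → R) :
    ∑ A : Finset α, ∑ B ∈ Aᶜ.powerset, f A B = ∑ T : Finset α, ∑ A ∈ T.powerset, f A (T \ A) := by
  rw [Finset.sum_sigma', Finset.sum_sigma']
  refine Finset.sum_bij' (fun x _ => ⟨x.1 ∪ x.2, x.1⟩) (fun x _ => ⟨x.2, x.1 \ x.2⟩) ?_ ?_ ?_ ?_ ?_
  · simp only [mem_sigma, mem_univ, mem_powerset, true_and]
    exact fun _ _ => subset_union_left
  · simp only [mem_sigma, mem_univ, mem_powerset, true_and, subset_compl_iff_disjoint_right]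
    exact fun _ _ => sdiff_disjoint
  · rintro ⟨A, B⟩ h
    simp only [mem_sigma, mem_univ, mem_powerset, true_and, subset_compl_iff_disjoint_right] at h
    simp [union_sdiff_cancel_left h.symm]
  · rintro ⟨T, A⟩ h
    simp only [mem_sigma, mem_univ, mem_powerset, true_and] at h
    simp [union_sdiff_of_subset h]
  · rintro ⟨A, B⟩ h
    simp only [mem_sigma, mem_univ, mem_powerset, true_and, subset_compl_iff_disjoint_right] at h
    simp [union_sdiff_cancel_left h.symm]

theorem sum_signed_Zmulti_contraction {α K : Type*} [Fintype α] [DecidableEq α]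
    [Field K] (r : Finset α → ℤ) (m : Finset α → K) {s : K} (hs : s ≠ 0) (u v : α → K) :
    (∑ A : Finset α,
        s ^ (-(r A)) * (∏ e ∈ A, (-v e)) * ZmultiCon r m A s v *
          (∏ e ∈ A, u e) * ∏ e ∈ Aᶜ, (1 - u e)) =
      ∑ T : Finset α, m T * s ^ (-(r T)) * (∏ e ∈ T, v e) *
        (∏ e ∈ T, (1 - 2 * u e)) * ∏ e ∈ Tᶜ, (1 - u e) := by
  simp only [ZmultiCon, mul_sum, sum_mul]
  rw [sum_sum_powerset_compl]
  refine sum_congr rfl fun T _ => ?_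
  have expand : ∏ e ∈ T, (1 - 2 * u e) =
      ∑ A ∈ T.powerset, (∏ e ∈ A, -u e) * ∏ e ∈ T \ A, (1 - u e) := by
    rw [← prod_add]
    exact prod_congr rfl fun e _ => by ring
  rw [expand, mul_sum, sum_mul]
  refine sum_congr rfl fun A hA => ?_
  rw [mem_powerset] at hA
  have hcompl : ∏ e ∈ Aᶜ, (1 - u e) = (∏ e ∈ T \ A, (1 - u e)) * ∏ e ∈ Tᶜ, (1 - u e) := by
    rw [← prod_union (disjoint_compl_right.mono_left sdiff_subset)]
    refine prod_congr ?_ fun _ _ => rfl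
    ext e
    have := @hA e
    simp only [mem_compl, mem_union, mem_sdiff]
    tauto
  have hpow : s ^ (-(r T)) = s ^ (-(r A)) * s ^ (r A - r T) := by
    rw [← zpow_add₀ hs]
    congr 1
    ring
  rw [union_sdiff_of_subset hA, hcompl, hpow, ← prod_sdiff hA (f := v), prod_neg, prod_neg]
  ring

/-- **Theorem 4.8** (signed multivariate Tutte polynomial of a random contraction): for an
rsm `M = (E,r,m)` over a field `K`, `s ≠ 0`, and all families `u, v`,
`∑_{A⊆E} s^{−r(A)} (−v)^A Z_{M/A}(s,v) u^A (1−u)^{E∖A}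
  = ∑_{T⊆E} m(T) s^{−r(T)} v^T (∏_{e∈T}(1−2u_e))(∏_{e∈E∖T}(1−u_e))`;
in particular, if `u_e ≠ 1` for all `e`, then
`E[s^{−r(E_u)} (−v)^{E_u} Z_{M/E_u}(s,v)] = (1−u)^E Z_M(s, (v_e(1−2u_e)/(1−u_e)))`. -/
theorem expectation_signed_Zmulti_contraction {α K : Type*} [Fintype α] [DecidableEq α]
    [Field K] (r : Finset α → ℤ) (m : Finset α → K) (s : K) (hs : s ≠ 0) (u v : α → K) :
    ((∑ A : Finset α,
        s ^ (-(r A)) * (∏ e ∈ A, (-v e)) * ZmultiCon r m A s v *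
          (∏ e ∈ A, u e) * ∏ e ∈ Aᶜ, (1 - u e)) =
      ∑ T : Finset α, m T * s ^ (-(r T)) * (∏ e ∈ T, v e) *
        (∏ e ∈ T, (1 - 2 * u e)) * ∏ e ∈ Tᶜ, (1 - u e)) ∧
    ((∀ e, u e ≠ 1) →
      (∑ A : Finset α,
          s ^ (-(r A)) * (∏ e ∈ A, (-v e)) * ZmultiCon r m A s v *
            (∏ e ∈ A, u e) * ∏ e ∈ Aᶜ, (1 - u e)) =
        (∏ e : α, (1 - u e)) *
          ∑ T : Finset α, m T * s ^ (-(r T)) *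
            ∏ e ∈ T, (v e * (1 - 2 * u e) / (1 - u e))) := by
  refine ⟨sum_signed_Zmulti_contraction r m hs u v, fun hu => ?_⟩
  rw [sum_signed_Zmulti_contraction r m hs u v, mul_sum]
  refine sum_congr rfl fun T _ => ?_
  have hne : ∏ e ∈ T, (1 - u e) ≠ 0 :=
    prod_ne_zero_iff.mpr fun e _ => sub_ne_zero.mpr (hu e).symm
  rw [prod_div_distrib, prod_mul_distrib, ← prod_mul_prod_compl T fun e => 1 - u e]
  field_simp
end
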